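/- Let X be an n×p real matrix, β ∈ ℝ^p, ε ∈ ℝⁿ, Y = Xβ + ε, let β_init be a Lasso minimizer with penalty λ_n > 0, and suppose ‖Xᵀε/n‖_∞ ≤ λ_n/2. Let T₀ ⊆ {1,…,p} with |T₀| ≤ s₀, β₀ = β_{T₀}, h = β_init − β₀, δ = β_init − β. Suppose additionally that ‖Xδ‖₂²/n + ‖Xh‖₂²/n ≤ λ_n·‖h_{T₀}‖₁. Then ‖h_{T₀^c}‖₁ ≤ 4·‖h_{T₀}‖₁. If moreover X satisfies RE(s₀,4,X) with constant K = K(s₀,4), then ‖Xh‖₂/√n ≤ K·λ_n·√s₀, ‖Xδ‖₂/√n ≤ K·λ_n·√s₀/2, ‖h_{T₀}‖₂ ≤ K²·λ_n·√s₀, and ‖h_{T₀^c}‖₁ ≤ 4K²·λ_n·s₀. -/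

import Mathlib

open Finset Matrix Real
open scoped BigOperators Classical

noncomputable section

namespace ThreshLasso

/-- ℓ₂ norm of a finite real vector. -/
def l2 {m : ℕ} (v : Fin m → ℝ) : ℝ := Real.sqrt (∑ i, (v i) ^ 2)

/-- ℓ₁ norm of a finite real vector. -/
def l1 {m : ℕ} (v : Fin m → ℝ) : ℝ := ∑ i, |v i|

/-- Restriction of a vector to a set of coordinates (zero outside). -/
def restr {p : ℕ} (v : Fin p → ℝ) (T : Finset (Fin p)) : Fin p → ℝ :=
  fun j => if j ∈ T then v j else 0

/-- Support of a vector, as a `Finset`. -/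
def supp {p : ℕ} (v : Fin p → ℝ) : Finset (Fin p) :=
  Finset.univ.filter fun j => v j ≠ 0

/-- `L` is the minimal `m`-sparse eigenvalue `Λ_min(m)` of `X`:
the least value of `‖Xv‖₂²/(n‖v‖₂²)` over nonzero `v` with at most `m`
nonzero coordinates. -/
def IsLambdaMin {n p : ℕ} (X : Matrix (Fin n) (Fin p) ℝ) (m : ℕ) (L : ℝ) : Prop :=
  IsLeast {r : ℝ | ∃ v : Fin p → ℝ, v ≠ 0 ∧ (supp v).card ≤ m ∧
    r = (l2 (X.mulVec v)) ^ 2 / (n * (l2 v) ^ 2)} L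

/-- `L` is the maximal `m`-sparse eigenvalue `Λ_max(m)` of `X`
(with the convention `Λ_max(0) = 0`, implemented by inserting `0` in the set,
which does not change the maximum when `m ≥ 1`). -/
def IsLambdaMax {n p : ℕ} (X : Matrix (Fin n) (Fin p) ℝ) (m : ℕ) (L : ℝ) : Prop :=
  IsGreatest (insert (0 : ℝ) {r : ℝ | ∃ v : Fin p → ℝ, v ≠ 0 ∧ (supp v).card ≤ m ∧
    r = (l2 (X.mulVec v)) ^ 2 / (n * (l2 v) ^ 2)}) L

/-- `θ` is the restricted orthogonality constant `θ_{m,m'}` of `X`: the smallest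
nonnegative `t` such that `|⟨Xu, Xu'⟩|/n ≤ t‖u‖₂‖u'‖₂` for all `u, u'` supported
on disjoint sets of cardinality at most `m`, `m'` respectively. -/
def IsTheta {n p : ℕ} (X : Matrix (Fin n) (Fin p) ℝ) (m m' : ℕ) (θ : ℝ) : Prop :=
  IsLeast {t : ℝ | 0 ≤ t ∧ ∀ (u u' : Fin p → ℝ) (T T' : Finset (Fin p)),
    Disjoint T T' → T.card ≤ m → T'.card ≤ m' →
    (∀ j, j ∉ T → u j = 0) → (∀ j, j ∉ T' → u' j = 0) →
    |∑ i, (X.mulVec u i) * (X.mulVec u' i)| / n ≤ t * (l2 u * l2 u')} θ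

/-- Restricted eigenvalue condition `RE(s₀, k₀, X)` with constant `K`. -/
def RECond {n p : ℕ} (X : Matrix (Fin n) (Fin p) ℝ) (s₀ : ℕ) (k₀ K : ℝ) : Prop :=
  0 < K ∧ ∀ (v : Fin p → ℝ) (J : Finset (Fin p)), J.card ≤ s₀ →
    l1 (restr v Jᶜ) ≤ k₀ * l1 (restr v J) →
    l2 (restr v J) / K ≤ l2 (X.mulVec v) / Real.sqrt n

/-- `s₀` is the essential sparsity of `β`: the smallest nonnegative integer `m`
with `∑ᵢ min(βᵢ², λ²σ²) ≤ m λ²σ²`. -/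
def EssSparsity {p : ℕ} (β : Fin p → ℝ) (lam σ : ℝ) (s₀ : ℕ) : Prop :=
  IsLeast {m : ℕ | ∑ i, min ((β i) ^ 2) (lam ^ 2 * σ ^ 2) ≤ (m : ℝ) * (lam ^ 2 * σ ^ 2)} s₀

/-- `T₀` is a set of indices of the `s₀` largest coordinates of `β` in absolute value. -/
def TopSet {p : ℕ} (β : Fin p → ℝ) (s₀ : ℕ) (T₀ : Finset (Fin p)) : Prop :=
  T₀.card = s₀ ∧ ∀ i ∈ T₀, ∀ j, j ∉ T₀ → |β j| ≤ |β i|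

/-- `T₁` is a set of indices of the `s₀` largest coordinates of `h` in absolute
value outside `T₀`. -/
def TopSetOutside {p : ℕ} (h : Fin p → ℝ) (s₀ : ℕ) (T₀ T₁ : Finset (Fin p)) : Prop :=
  T₁.card = s₀ ∧ Disjoint T₀ T₁ ∧
    ∀ i ∈ T₁, ∀ j, j ∉ T₀ → j ∉ T₁ → |h j| ≤ |h i|

/-- `b` is a Lasso minimizer with penalty `lamn` for data `(X, Y)`. -/
def IsLassoSol {n p : ℕ} (X : Matrix (Fin n) (Fin p) ℝ) (Y : Fin n → ℝ)
    (lamn : ℝ) (b : Fin p → ℝ) : Prop :=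
  ∀ b' : Fin p → ℝ,
    1 / (2 * n) * (l2 (Y - X.mulVec b)) ^ 2 + lamn * l1 b ≤
    1 / (2 * n) * (l2 (Y - X.mulVec b')) ^ 2 + lamn * l1 b'

/-- Submatrix of the columns of `X` indexed by `I`. -/
def colSub {n p : ℕ} (X : Matrix (Fin n) (Fin p) ℝ) (I : Finset (Fin p)) :
    Matrix (Fin n) {j // j ∈ I} ℝ :=
  Matrix.of fun i j => X i j.1

/-- The Gram matrix `X_Iᵀ X_I` is invertible. -/
def GramInvertible {n p : ℕ} (X : Matrix (Fin n) (Fin p) ℝ) (I : Finset (Fin p)) : Prop :=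
  IsUnit ((colSub X I)ᵀ * colSub X I).det

/-- The OLS refit of `Y` on the columns of `X` indexed by `I`:
`(X_Iᵀ X_I)⁻¹ X_Iᵀ Y` on `I`, and `0` off `I`. -/
def olsRefit {n p : ℕ} (X : Matrix (Fin n) (Fin p) ℝ) (Y : Fin n → ℝ)
    (I : Finset (Fin p)) : Fin p → ℝ :=
  fun j => if h : j ∈ I then
    (((colSub X I)ᵀ * colSub X I)⁻¹).mulVec ((colSub X I)ᵀ.mulVec Y) ⟨j, h⟩
  else 0


lemma l2_sq {m : ℕ} (v : Fin m → ℝ) : l2 v ^ 2 = v ⬝ᵥ v := by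
  rw [l2, Real.sq_sqrt (Finset.sum_nonneg fun i _ => sq_nonneg _)]
  simp only [dotProduct, pow_two]

lemma l2_nonneg {m : ℕ} (v : Fin m → ℝ) : 0 ≤ l2 v := Real.sqrt_nonneg _

lemma l1_eq_restr_add_restr_compl {p : ℕ} (v : Fin p → ℝ) (T : Finset (Fin p)) :
    l1 v = l1 (restr v T) + l1 (restr v Tᶜ) := by
  simp only [l1, restr, ← Finset.sum_add_distrib]
  refine Finset.sum_congr rfl fun j _ => ?_
  by_cases hj : j ∈ T <;> simp [hj]

/-- A vector supported on `T` exceeds a perturbation of itself in `ℓ₁` norm by at most the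
`ℓ₁` norm of the perturbation on `T` minus that off `T`. -/
lemma l1_restr_sub_l1_le {p : ℕ} (v w : Fin p → ℝ) (T : Finset (Fin p)) :
    l1 (restr v T) - l1 w ≤
      l1 (restr (w - restr v T) T) - l1 (restr (w - restr v T) Tᶜ) := by
  simp only [l1, ← Finset.sum_sub_distrib]
  refine Finset.sum_le_sum fun j _ => ?_
  by_cases hj : j ∈ T
  · simpa [restr, hj, abs_sub_comm] using abs_sub_abs_le_abs_sub (v j) (w j)
  · simp [restr, hj]

lemma l1_restr_le_sqrt_mul_l2 {p s : ℕ} (v : Fin p → ℝ) (T : Finset (Fin p)) (hT : T.card ≤ s) :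
    l1 (restr v T) ≤ Real.sqrt s * l2 (restr v T) := by
  have h1 : l1 (restr v T) = ∑ j ∈ T, |v j| := by
    simp [l1, restr, apply_ite abs, Finset.sum_ite_mem]
  have h2 : ∑ j, restr v T j ^ 2 = ∑ j ∈ T, |v j| ^ 2 := by
    simp [restr, ite_pow, Finset.sum_ite_mem]
  rw [l2, h1, h2, ← Real.sqrt_mul (Nat.cast_nonneg s)]
  refine Real.le_sqrt_of_sq_le (sq_sum_le_card_mul_sum_sq.trans ?_)
  gcongr

/-- Hölder's inequality for the noise term. -/
lemma dotProduct_mulVec_div_le {n p : ℕ} (X : Matrix (Fin n) (Fin p) ℝ) (ε : Fin n → ℝ) {c : ℝ}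
    (hc : ∀ j, |(∑ i, X i j * ε i) / n| ≤ c) (v : Fin p → ℝ) :
    (ε ⬝ᵥ X.mulVec v) / n ≤ c * l1 v := by
  have h1 : (ε ⬝ᵥ X.mulVec v) / n = ∑ j, (∑ i, X i j * ε i) / n * v j := by
    rw [dotProduct_mulVec, dotProduct, Finset.sum_div]
    refine Finset.sum_congr rfl fun j _ => ?_
    simp only [vecMul, dotProduct, mul_comm (ε _)]
    ring
  rw [h1, l1, Finset.mul_sum]
  refine Finset.sum_le_sum fun j _ => (le_abs_self _).trans ?_
  rw [abs_mul]
  exact mul_le_mul_of_nonneg_right (hc j) (abs_nonneg _)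

lemma l1_sub_smul_le {p : ℕ} (b b' : Fin p → ℝ) {t : ℝ} (h0 : 0 ≤ t) (h1 : t ≤ 1) :
    l1 (b - t • (b - b')) ≤ (1 - t) * l1 b + t * l1 b' := by
  simp only [l1, Finset.mul_sum, ← Finset.sum_add_distrib]
  refine Finset.sum_le_sum fun j _ => ?_
  have : (b - t • (b - b')) j = (1 - t) * b j + t * b' j := by
    simp only [Pi.sub_apply, Pi.smul_apply, smul_eq_mul]
    ring
  rw [this]
  refine (abs_add_le _ _).trans ?_
  rw [abs_mul, abs_mul, abs_of_nonneg h0, abs_of_nonneg (sub_nonneg.2 h1)]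

/-- First-order optimality of a Lasso minimizer, in variational form. -/
lemma IsLassoSol.variational {n p : ℕ} {X : Matrix (Fin n) (Fin p) ℝ} {Y : Fin n → ℝ}
    {lamn : ℝ} (hlamn : 0 ≤ lamn) {b : Fin p → ℝ} (hb : IsLassoSol X Y lamn b)
    (b' : Fin p → ℝ) :
    lamn * (l1 b - l1 b') ≤ ((Y - X.mulVec b) ⬝ᵥ X.mulVec (b - b')) / n := by
  set r := Y - X.mulVec b with hr
  set d := X.mulVec (b - b') with hd
  have key (t : ℝ) (ht : 0 < t) (ht1 : t ≤ 1) :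
      lamn * (l1 b - l1 b') ≤ (r ⬝ᵥ d) / n + t * ((d ⬝ᵥ d) / (2 * n)) := by
    have h1 := hb (b - t • (b - b'))
    have h2 : Y - X.mulVec (b - t • (b - b')) = r + t • d := by
      rw [mulVec_sub, mulVec_smul, hr, hd]
      abel
    rw [h2, l2_sq, l2_sq, ← hr] at h1
    simp only [add_dotProduct, dotProduct_add, smul_dotProduct, dotProduct_smul, smul_eq_mul,
      dotProduct_comm d r] at h1
    have h3 := mul_le_mul_of_nonneg_left (l1_sub_smul_le b b' ht.le ht1) hlamn
    refine le_of_mul_le_mul_left ?_ ht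
    have h4 : 1 / (2 * (n : ℝ)) * (r ⬝ᵥ r + t * (r ⬝ᵥ d) + t * (r ⬝ᵥ d + t * (d ⬝ᵥ d))) =
        1 / (2 * (n : ℝ)) * (r ⬝ᵥ r) + t * ((r ⬝ᵥ d) / n + t * ((d ⬝ᵥ d) / (2 * n))) := by
      ring
    linarith
  have hlim : Filter.Tendsto (fun t : ℝ => (r ⬝ᵥ d) / n + t * ((d ⬝ᵥ d) / (2 * n)))
      (nhdsWithin 0 (Set.Ioi 0)) (nhds ((r ⬝ᵥ d) / n)) := by
    have : Continuous fun t : ℝ => (r ⬝ᵥ d) / n + t * ((d ⬝ᵥ d) / (2 * n)) := by fun_prop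
    simpa using (this.tendsto 0).mono_left nhdsWithin_le_nhds
  refine ge_of_tendsto hlim ?_
  filter_upwards [Ioc_mem_nhdsGT (zero_lt_one (α := ℝ))] with t ht
  exact key t ht.1 ht.2

/-- Case 2 of the Lasso analysis: cone membership and bounds
under RE(s₀,4,X). -/
theorem statement_17
    (n p s₀ : ℕ) (hn : 0 < n)
    (X : Matrix (Fin n) (Fin p) ℝ) (β : Fin p → ℝ) (ε Y : Fin n → ℝ)
    (hY : Y = X.mulVec β + ε)
    (lamn : ℝ) (hlamn : 0 < lamn)
    (βinit : Fin p → ℝ) (hinit : IsLassoSol X Y lamn βinit)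
    (hnoise : ∀ j, |(∑ i, X i j * ε i) / n| ≤ lamn / 2)
    (T₀ : Finset (Fin p)) (hT₀ : T₀.card ≤ s₀)
    (β₀ h δ : Fin p → ℝ) (hβ₀ : β₀ = restr β T₀)
    (hh : h = βinit - β₀) (hδ : δ = βinit - β)
    (hcase : (l2 (X.mulVec δ)) ^ 2 / n + (l2 (X.mulVec h)) ^ 2 / n ≤
      lamn * l1 (restr h T₀))
    (K : ℝ) :
    l1 (restr h T₀ᶜ) ≤ 4 * l1 (restr h T₀) ∧
    (RECond X s₀ 4 K →
      l2 (X.mulVec h) / Real.sqrt n ≤ K * lamn * Real.sqrt s₀ ∧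
      l2 (X.mulVec δ) / Real.sqrt n ≤ K * lamn * Real.sqrt s₀ / 2 ∧
      l2 (restr h T₀) ≤ K ^ 2 * lamn * Real.sqrt s₀ ∧
      l1 (restr h T₀ᶜ) ≤ 4 * K ^ 2 * lamn * s₀) := by
  set a := X.mulVec δ with ha
  set b := X.mulVec h with hb
  have cone : l1 (restr h T₀ᶜ) ≤ 4 * l1 (restr h T₀) := by
    have h1 := hinit.variational hlamn.le β₀
    have h2 : Y - X.mulVec βinit = ε - a := by
      rw [ha, hδ, mulVec_sub, hY]
      abel
    rw [← hh, ← hb, h2, sub_dotProduct, sub_div] at h1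
    have h3 := dotProduct_mulVec_div_le X ε hnoise h
    rw [← hb, l1_eq_restr_add_restr_compl h T₀] at h3
    have h4 := l1_restr_sub_l1_le β βinit T₀
    rw [← hβ₀, ← hh] at h4
    have h5 := mul_le_mul_of_nonneg_left h4 hlamn.le
    have h6 : 0 ≤ l2 (a + b) ^ 2 / n := by positivity
    have h7 : l2 (a + b) ^ 2 / n = l2 a ^ 2 / n + l2 b ^ 2 / n + 2 * ((a ⬝ᵥ b) / n) := by
      simp only [l2_sq, add_dotProduct, dotProduct_add, dotProduct_comm b a]
      ring
    refine le_of_mul_le_mul_left ?_ hlamn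
    linarith
  refine ⟨cone, fun ⟨hK, hRE⟩ => ?_⟩
  have hre := hRE h T₀ hT₀ cone
  rw [← hb, div_le_iff₀ hK] at hre
  have hcs := l1_restr_le_sqrt_mul_l2 h T₀ hT₀
  have hsq (v : Fin n → ℝ) : l2 v ^ 2 / n = (l2 v / Real.sqrt n) ^ 2 := by
    rw [div_pow, Real.sq_sqrt (Nat.cast_nonneg n)]
  rw [hsq, hsq] at hcase
  have hA : 0 ≤ l2 a / Real.sqrt n := div_nonneg (l2_nonneg _) (Real.sqrt_nonneg _)
  have hB : 0 ≤ l2 b / Real.sqrt n := div_nonneg (l2_nonneg _) (Real.sqrt_nonneg _)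
  set A := l2 a / Real.sqrt n
  set B := l2 b / Real.sqrt n
  have hs : Real.sqrt s₀ ^ 2 = s₀ := Real.sq_sqrt (Nat.cast_nonneg s₀)
  have hs0 := Real.sqrt_nonneg (s₀ : ℝ)
  set q := Real.sqrt (s₀ : ℝ)
  have hc : 0 ≤ K * lamn * q := by positivity
  have hl1 : l1 (restr h T₀) ≤ q * (B * K) :=
    hcs.trans (mul_le_mul_of_nonneg_left hre hs0)
  have hquad : A ^ 2 + B ^ 2 ≤ K * lamn * q * B := by
    linarith [mul_le_mul_of_nonneg_left hl1 hlamn.le]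
  have hBc : B ≤ K * lamn * q := by
    by_contra! hlt
    nlinarith [mul_pos (hc.trans_lt hlt) (sub_pos.2 hlt), sq_nonneg A]
  have hBK : B * K ≤ K ^ 2 * lamn * q := by
    linarith [mul_le_mul_of_nonneg_right hBc hK.le]
  refine ⟨hBc, ?_, hre.trans hBK, ?_⟩
  · refine (sq_le_sq₀ hA (by positivity)).1 ?_
    linarith [sq_nonneg (K * lamn * q / 2 - B)]
  · have h1 := hl1.trans (mul_le_mul_of_nonneg_left hBK hs0)
    have h2 : q * (K ^ 2 * lamn * q) = K ^ 2 * lamn * s₀ := by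
      rw [← hs]
      ring
    linarith

end ThreshLasso
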